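/- Let 1 < β ≤ 2 and 1 < γ ≤ 2, let M₁, M₂ ≥ 2 be integers, let μ₀, K₁, K₂, ν_β, ν_γ > 0, and let l be an integer with 1 ≤ l ≤ min(M₁−1, M₂−1). Then the truncated preconditioner K_l = μ₀·I₁ + I₂ ⊗ (K₁·ν_β·T_l(G_β)) + (K₂·ν_γ·T_l(G_γ)) ⊗ I₃ is a symmetric positive definite matrix, where I₁, I₂, I₃ are identity matrices of orders (M₁−1)(M₂−1), M₂−1 and M₁−1 respectively and ⊗ is the Kronecker product. -/

import Mathlib

/-- Fractional centered difference coefficients `ĝ_k^{(β)}`. -/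
noncomputable def ghat (β : ℝ) (k : ℤ) : ℝ :=
  (-1 : ℝ) ^ k * Real.Gamma (β + 1) /
    (Real.Gamma (β / 2 - k + 1) * Real.Gamma (β / 2 + k + 1))

/-- The `(M−1)×(M−1)` symmetric Toeplitz matrix `G_β`. -/
noncomputable def Gmat (β : ℝ) (M : ℕ) : Matrix (Fin (M - 1)) (Fin (M - 1)) ℝ :=
  Matrix.of fun i j => ghat β ((i : ℤ) - (j : ℤ))

/-- First column of the circulant approximation `r(G_β)`. -/
noncomputable def rcol (β : ℝ) (M : ℕ) (k : ℕ) : ℝ :=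
  if k = 0 then ghat β 0 else ghat β k + ghat β ((k : ℤ) - ((M : ℤ) - 1))

/-- The `(M−1)×(M−1)` circulant matrix `r(G_β)`. -/
noncomputable def circG (β : ℝ) (M : ℕ) : Matrix (Fin (M - 1)) (Fin (M - 1)) ℝ :=
  Matrix.of fun i j => rcol β M ((((i : ℤ) - (j : ℤ)) % ((M : ℤ) - 1)).toNat)

/-- The constant `c_*^{(β)} = (2/β) r_β`. -/
noncomputable def cstar (β : ℝ) : ℝ :=
  (2 / β) * (Real.exp (-2) * ((4 - β) * (2 - β) * β) / ((6 + β) * (4 + β) * (2 + β)) *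
    (Real.Gamma (β + 1) / (Real.Gamma (β / 2 + 1)) ^ 2) * (3 + β / 2) ^ (β + 1))

/-- Grünwald coefficients `g_k^{(γ)}`. -/
noncomputable def gcoef (γ : ℝ) : ℕ → ℝ
  | 0 => 1
  | (k + 1) => (1 - (γ + 1) / (k + 1)) * gcoef γ k

/-- Weighted and shifted Grünwald coefficients `λ_k^{(γ)}`. -/
noncomputable def lamc (γ : ℝ) : ℕ → ℝ
  | 0 => 1 + γ / 2
  | (k + 1) => (1 + γ / 2) * gcoef γ (k + 1) - (γ / 2) * gcoef γ k

/-- The `l`-truncation of a square matrix: keep entries with `|i − j| ≤ l`. -/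
def trunc {n : ℕ} (l : ℕ) (G : Matrix (Fin n) (Fin n) ℝ) : Matrix (Fin n) (Fin n) ℝ :=
  Matrix.of fun i j => if |(i : ℤ) - (j : ℤ)| ≤ (l : ℤ) then G i j else 0

theorem ghat_neg (β : ℝ) (k : ℤ) : ghat β (-k) = ghat β k := by
  unfold ghat
  have h : (-1 : ℝ) ^ (-k) = (-1 : ℝ) ^ k := by
    rw [zpow_neg, ← inv_zpow]; norm_num
  rw [h]
  push_cast
  rw [show β / 2 - -(k : ℝ) + 1 = β / 2 + k + 1 by ring,
    show β / 2 + -(k : ℝ) + 1 = β / 2 - k + 1 by ring, mul_comm (Real.Gamma (β / 2 + k + 1))]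

theorem ghat_succ (β : ℝ) (hβ : 0 < β) (k : ℕ) :
    ghat β ((k + 1 : ℕ) : ℤ) * (β / 2 + k + 1) = (k - β / 2) * ghat β (k : ℤ) := by
  unfold ghat
  have hpos : (0 : ℝ) < β / 2 + k + 1 := by positivity
  have hG : Real.Gamma (β / 2 + k + 1 + 1) = (β / 2 + k + 1) * Real.Gamma (β / 2 + k + 1) :=
    Real.Gamma_add_one hpos.ne'
  have hGp : Real.Gamma (β / 2 + k + 1) ≠ 0 := (Real.Gamma_pos_of_pos hpos).ne'
  push_cast
  rw [show β / 2 - ((k : ℝ) + 1) + 1 = β / 2 - k by ring,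
    show β / 2 + ((k : ℝ) + 1) + 1 = β / 2 + k + 1 + 1 by ring, hG,
    zpow_add₀ (by norm_num : (-1 : ℝ) ≠ 0)]
  by_cases h : β / 2 - (k : ℝ) = 0
  · rw [h, show (k : ℝ) - β / 2 = 0 by linarith]
    simp
  · rw [Real.Gamma_add_one h]
    have h2 : (k : ℝ) - β / 2 = -(β / 2 - k) := by ring
    rw [h2]
    by_cases h3 : Real.Gamma (β / 2 - k) = 0
    · simp [h3]
    · have hp' := hpos.ne'
      clear hG h2 hpos
      generalize Real.Gamma (β / 2 - k) = a at *
      generalize Real.Gamma (β / 2 + k + 1) = b at *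
      generalize β / 2 - (k : ℝ) = c at *
      generalize β / 2 + (k : ℝ) + 1 = d at *
      field_simp
      try simp

theorem ghat_zero_nonneg (β : ℝ) (hβ : 0 < β) : 0 ≤ ghat β 0 := by
  unfold ghat
  have h1 := Real.Gamma_pos_of_pos (show 0 < β + 1 by linarith)
  have h2 := Real.Gamma_pos_of_pos (show 0 < β / 2 + 1 by linarith)
  simp
  positivity

theorem ghat_nat_nonpos (β : ℝ) (hβ : 0 < β) (hβ2 : β ≤ 2) (k : ℕ) :
    ghat β ((k + 1 : ℕ) : ℤ) ≤ 0 := by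
  induction k with
  | zero =>
    have h := ghat_succ β hβ 0
    have h0 := ghat_zero_nonneg β hβ
    simp only [Nat.cast_zero, add_zero, zero_sub] at h
    by_contra hc
    push Not at hc
    nlinarith [mul_pos hc (show 0 < β / 2 + 1 by linarith)]
  | succ k ih =>
    have h := ghat_succ β hβ (k + 1)
    by_contra hc
    push Not at hc
    have hp : (0 : ℝ) < β / 2 + (k + 1 : ℕ) + 1 := by positivity
    have hq : (0 : ℝ) ≤ ((k + 1 : ℕ) : ℝ) - β / 2 := by
      push_cast
      have : (0 : ℝ) ≤ k := by positivity
      linarith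
    nlinarith [mul_pos hc hp, mul_nonneg hq (neg_nonneg.2 ih)]

theorem ghat_nonpos (β : ℝ) (hβ : 0 < β) (hβ2 : β ≤ 2) (k : ℤ) (hk : k ≠ 0) :
    ghat β k ≤ 0 := by
  have key : ∀ n : ℕ, n ≠ 0 → ghat β (n : ℤ) ≤ 0 := by
    intro n hn
    obtain ⟨m, rfl⟩ := Nat.exists_eq_succ_of_ne_zero hn
    exact ghat_nat_nonpos β hβ hβ2 m
  obtain ⟨n, rfl | rfl⟩ := k.eq_nat_or_neg
  · exact key n (by simpa using hk)
  · rw [ghat_neg]; exact key n (by simpa using hk)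

theorem ghat_sum (β : ℝ) (hβ : 0 < β) (k : ℕ) :
    (β / 2) * (2 * ∑ m ∈ Finset.range (k + 1), ghat β (m : ℤ) - ghat β 0)
      = (β / 2 - k) * ghat β (k : ℤ) := by
  induction k with
  | zero => simp only [zero_add, Finset.sum_range_one, Nat.cast_zero]; ring
  | succ k ih =>
    rw [Finset.sum_range_succ]
    have h := ghat_succ β hβ k
    push_cast at h ih ⊢
    linarith

theorem ghat_Icc_nonneg (β : ℝ) (hβ : 0 < β) (hβ2 : β ≤ 2) (l : ℕ) :
    0 ≤ ∑ m ∈ Finset.Icc (-(l : ℤ)) l, ghat β m := by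
  rw [Finset.sum_Icc_of_even_eq_range (fun k => ghat_neg β k)]
  have h := ghat_sum β hβ l
  have hr : 0 ≤ (β / 2 - l) * ghat β (l : ℤ) := by
    rcases Nat.eq_zero_or_pos l with rfl | hl
    · have := ghat_zero_nonneg β hβ
      simp
      positivity
    · have h1 := ghat_nonpos β hβ hβ2 l (by exact_mod_cast hl.ne')
      have h2 : (1 : ℝ) ≤ l := by exact_mod_cast hl
      exact mul_nonneg_of_nonpos_of_nonpos (by linarith) h1
  rw [← h] at hr
  have := nonneg_of_mul_nonneg_right hr (by positivity)
  simpa using this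

theorem trunc_row_nonneg (β : ℝ) (hβ : 0 < β) (hβ2 : β ≤ 2) (M l : ℕ) (i : Fin (M - 1)) :
    0 ≤ ∑ j, trunc l (Gmat β M) i j := by
  simp only [trunc, Gmat, Matrix.of_apply]
  rw [← Finset.sum_filter]
  have hinj : Function.Injective (fun j : Fin (M - 1) => (i : ℤ) - (j : ℤ)) := by
    intro a b h
    simp only at h
    ext
    omega
  rw [← Finset.sum_image (f := fun k => ghat β k) (g := fun j : Fin (M - 1) => (i : ℤ) - (j : ℤ))
    hinj.injOn]
  refine (ghat_Icc_nonneg β hβ hβ2 l).trans ?_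
  rw [← neg_le_neg_iff, ← Finset.sum_neg_distrib, ← Finset.sum_neg_distrib]
  refine Finset.sum_le_sum_of_subset_of_nonneg ?_ ?_
  · intro k hk
    simp only [Finset.mem_image, Finset.mem_filter] at hk
    obtain ⟨j, ⟨-, hj⟩, rfl⟩ := hk
    exact Finset.mem_Icc.2 (abs_le.1 hj)
  · intro k _ hk
    rw [neg_nonneg]
    refine ghat_nonpos β hβ hβ2 k ?_
    rintro rfl
    apply hk
    simp only [Finset.mem_image, Finset.mem_filter]
    exact ⟨i, ⟨Finset.mem_univ _, by simp⟩, by simp⟩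

theorem trunc_symm (β : ℝ) (M l : ℕ) (i j : Fin (M - 1)) :
    trunc l (Gmat β M) j i = trunc l (Gmat β M) i j := by
  simp only [trunc, Gmat, Matrix.of_apply]
  rw [abs_sub_comm, ← ghat_neg, neg_sub]

theorem trunc_posSemidef (β : ℝ) (hβ : 0 < β) (hβ2 : β ≤ 2) (M l : ℕ) :
    (trunc l (Gmat β M)).PosSemidef := by
  refine Matrix.PosSemidef.of_dotProduct_mulVec_nonneg ?_ ?_
  · ext i j
    simpa using trunc_symm β M l i j
  · intro x
    have hoff : ∀ i j, i ≠ j → trunc l (Gmat β M) i j ≤ 0 := by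
      intro i j hij
      simp only [trunc, Gmat, Matrix.of_apply]
      split_ifs
      · refine ghat_nonpos β hβ hβ2 _ ?_
        intro h
        apply hij
        ext
        omega
      · exact le_rfl
    have hrow := trunc_row_nonneg β hβ hβ2 M l
    have hsymm := trunc_symm β M l
    generalize trunc l (Gmat β M) = A at *
    have h1 : star x ⬝ᵥ A.mulVec x = ∑ i, ∑ j, A i j * (x i * x j) := by
      simp only [dotProduct, Matrix.mulVec, Finset.mul_sum, Pi.star_apply, star_trivial]
      refine Finset.sum_congr rfl fun i _ => Finset.sum_congr rfl fun j _ => by ring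
    have h2 : ∑ i, ∑ j, A i j * (x i ^ 2 / 2 + x j ^ 2 / 2) ≤ ∑ i, ∑ j, A i j * (x i * x j) := by
      refine Finset.sum_le_sum fun i _ => Finset.sum_le_sum fun j _ => ?_
      by_cases h : i = j
      · subst h
        exact le_of_eq (by ring)
      · nlinarith [mul_nonneg (neg_nonneg.2 (hoff i j h)) (sq_nonneg (x i - x j))]
    have h3 : ∑ i, ∑ j, A i j * (x i ^ 2 / 2 + x j ^ 2 / 2) = ∑ i, x i ^ 2 * ∑ j, A i j := by
      simp only [mul_add, Finset.sum_add_distrib]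
      rw [Finset.sum_comm (f := fun i j => A i j * (x j ^ 2 / 2)), ← Finset.sum_add_distrib]
      refine Finset.sum_congr rfl fun i _ => ?_
      rw [← Finset.sum_add_distrib, Finset.mul_sum]
      refine Finset.sum_congr rfl fun j _ => ?_
      rw [hsymm i j]; ring
    rw [h1]
    refine le_trans ?_ h2
    rw [h3]
    exact Finset.sum_nonneg fun i _ => mul_nonneg (sq_nonneg _) (hrow i)

open Kronecker in
/-- the truncated preconditioner
`K_l = μ₀ I₁ + I₂ ⊗ (K₁ ν_β T_l(G_β)) + (K₂ ν_γ T_l(G_γ)) ⊗ I₃` is symmetric positive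
definite. -/
theorem stmt8 (β γ : ℝ) (hβ1 : 1 < β) (hβ2 : β ≤ 2) (hγ1 : 1 < γ) (hγ2 : γ ≤ 2)
    (M₁ M₂ : ℕ) (hM₁ : 2 ≤ M₁) (hM₂ : 2 ≤ M₂)
    (μ₀ K₁ K₂ νβ νγ : ℝ) (hμ : 0 < μ₀) (hK₁ : 0 < K₁) (hK₂ : 0 < K₂)
    (hνβ : 0 < νβ) (hνγ : 0 < νγ)
    (l : ℕ) (hl1 : 1 ≤ l) (hl2 : l ≤ min (M₁ - 1) (M₂ - 1)) :
    let Kl : Matrix (Fin (M₂ - 1) × Fin (M₁ - 1)) (Fin (M₂ - 1) × Fin (M₁ - 1)) ℝ :=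
      μ₀ • (1 : Matrix (Fin (M₂ - 1) × Fin (M₁ - 1)) (Fin (M₂ - 1) × Fin (M₁ - 1)) ℝ) +
        (1 : Matrix (Fin (M₂ - 1)) (Fin (M₂ - 1)) ℝ) ⊗ₖ ((K₁ * νβ) • trunc l (Gmat β M₁)) +
        ((K₂ * νγ) • trunc l (Gmat γ M₂)) ⊗ₖ (1 : Matrix (Fin (M₁ - 1)) (Fin (M₁ - 1)) ℝ)
    Kl.IsSymm ∧ Kl.PosDef := by
  intro Kl
  have hp : Kl.PosDef := by
    have h1 := (trunc_posSemidef β (by linarith) hβ2 M₁ l).smul (mul_pos hK₁ hνβ).le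
    have h2 := (trunc_posSemidef γ (by linarith) hγ2 M₂ l).smul (mul_pos hK₂ hνγ).le
    exact ((Matrix.PosDef.one.smul hμ).add_posSemidef
      (Matrix.PosSemidef.one.kronecker h1)).add_posSemidef (h2.kronecker Matrix.PosSemidef.one)
  refine ⟨?_, hp⟩
  have := hp.isHermitian
  rwa [Matrix.IsHermitian, Matrix.conjTranspose_eq_transpose_of_trivial] at this
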